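/- Let d be a positive integer and let L = L_{2d} = ⟨−2d⟩ ⊕ U ⊕ U ⊕ E8(−1) ⊕ E8(−1), the even lattice of rank 21 and signature (2,19) whose discriminant group is cyclic of order 2d. Let I ⊆ L be a primitive totally isotropic sublattice of rank 2, and let H_I = (I^⊥_{L^∨})^⊥_{L^∨} / I, where both orthogonal complements are taken inside the dual lattice L^∨ with respect to the ℚ-bilinear extension of the form. Suppose H_I is cyclic of order N (N is the imprimitivity of I). Then N² divides d, and the discriminant group of the even lattice K = I^⊥_L / I (the orthogonal complement of I in L modulo I, with the induced bilinear form) is cyclic of order 2m, where m = d/N². -/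

import Mathlib

open TensorProduct

/-- Entries of the Gram matrix of `E8(−1)`: the negative of the `E8` Cartan matrix.
The Dynkin diagram of `E8` is taken to be the chain `0—1—2—3—4—5—6` with the extra
node `7` attached to node `2`. -/
def e8negEntry : ℕ → ℕ → ℤ := fun i j =>
  if i = j then -2
  else if (i + 1 = j ∧ j ≤ 6) ∨ (j + 1 = i ∧ i ≤ 6) ∨ (i = 2 ∧ j = 7) ∨ (i = 7 ∧ j = 2)
    then 1
  else 0

/-- The Gram matrix of `L_{2d} = ⟨−2d⟩ ⊕ U ⊕ U ⊕ E8(−1) ⊕ E8(−1)`, the even lattice of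
rank 21 and signature `(2,19)` with cyclic discriminant group of order `2d`:
index `0` carries `⟨−2d⟩`, indices `{1,2}` and `{3,4}` carry hyperbolic planes `U`,
and indices `5,…,12` and `13,…,20` carry two copies of `E8(−1)`. -/
def gramK3 (d : ℕ) : Matrix (Fin 21) (Fin 21) ℤ := fun i j =>
  if (i : ℕ) = 0 ∧ (j : ℕ) = 0 then -(2 * (d : ℤ))
  else if ((i : ℕ) = 1 ∧ (j : ℕ) = 2) ∨ ((i : ℕ) = 2 ∧ (j : ℕ) = 1)
      ∨ ((i : ℕ) = 3 ∧ (j : ℕ) = 4) ∨ ((i : ℕ) = 4 ∧ (j : ℕ) = 3) then 1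
  else if 5 ≤ (i : ℕ) ∧ (i : ℕ) ≤ 12 ∧ 5 ≤ (j : ℕ) ∧ (j : ℕ) ≤ 12 then
    e8negEntry ((i : ℕ) - 5) ((j : ℕ) - 5)
  else if 13 ≤ (i : ℕ) ∧ (i : ℕ) ≤ 20 ∧ 13 ≤ (j : ℕ) ∧ (j : ℕ) ≤ 20 then
    e8negEntry ((i : ℕ) - 13) ((j : ℕ) - 13)
  else 0

/-- The bilinear form of the lattice `L_{2d}` on `Fin 21 → ℤ`. -/
noncomputable def bilinK3 (d : ℕ) : (Fin 21 → ℤ) →ₗ[ℤ] (Fin 21 → ℤ) →ₗ[ℤ] ℤ :=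
  Matrix.toLinearMap₂' ℤ (gramK3 d)

/-- The rational extension of the bilinear form of `L_{2d}`, on `Fin 21 → ℚ`. -/
noncomputable def bilinK3Q (d : ℕ) : (Fin 21 → ℚ) →ₗ[ℚ] (Fin 21 → ℚ) →ₗ[ℚ] ℚ :=
  Matrix.toLinearMap₂' ℚ ((gramK3 d).map (Int.cast : ℤ → ℚ))

/-- The inclusion `L ⊆ L ⊗ ℚ`, concretely `(Fin 21 → ℤ) → (Fin 21 → ℚ)`. -/
def castMap : (Fin 21 → ℤ) →ₗ[ℤ] (Fin 21 → ℚ) :=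
  LinearMap.pi fun i => (Int.castAddHom ℚ).toIntLinearMap.comp (LinearMap.proj i)

/-- The subgroup `{x ∈ V : (x, y) ∈ ℤ for all y ∈ S}` of a rational bilinear space,
dual to a subset `S`. -/
def dualAddSubgroup {V : Type*} [AddCommGroup V] [Module ℚ V]
    (BQ : V →ₗ[ℚ] V →ₗ[ℚ] ℚ) (S : Set V) : AddSubgroup V where
  carrier := {x | ∀ y ∈ S, ∃ k : ℤ, BQ x y = (k : ℚ)}
  add_mem' := by
    intro a b ha hb y hy
    obtain ⟨k, hk⟩ := ha y hy
    obtain ⟨l, hl⟩ := hb y hy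
    exact ⟨k + l, by rw [map_add, LinearMap.add_apply, hk, hl]; push_cast; ring⟩
  zero_mem' := by intro y hy; exact ⟨0, by simp⟩
  neg_mem' := by
    intro x hx y hy
    obtain ⟨k, hk⟩ := hx y hy
    exact ⟨-k, by rw [map_neg, LinearMap.neg_apply, hk]; push_cast; ring⟩

/-- The dual lattice `L_{2d}^∨ ⊆ L_{2d} ⊗ ℚ`. -/
noncomputable def dualK3 (d : ℕ) : AddSubgroup (Fin 21 → ℚ) :=
  dualAddSubgroup (bilinK3Q d) (Set.range castMap)

/-- The orthogonal complement of a subset `S`, taken within a subgroup `D` of a rational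
bilinear space. -/
def orthoWithin {V : Type*} [AddCommGroup V] [Module ℚ V]
    (BQ : V →ₗ[ℚ] V →ₗ[ℚ] ℚ) (D : AddSubgroup V) (S : Set V) : AddSubgroup V where
  carrier := {x | x ∈ D ∧ ∀ y ∈ S, BQ x y = 0}
  add_mem' := by
    intro a b ha hb
    exact ⟨add_mem ha.1 hb.1, fun y hy => by
      rw [map_add, LinearMap.add_apply, ha.2 y hy, hb.2 y hy, add_zero]⟩
  zero_mem' := ⟨zero_mem _, fun y _ => by simp⟩
  neg_mem' := by
    intro x hx
    exact ⟨neg_mem hx.1, fun y hy => by rw [map_neg, LinearMap.neg_apply, hx.2 y hy, neg_zero]⟩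

/-- `I^⊥_{L^∨}`: the orthogonal complement of the isotropic plane `I` inside the dual
lattice `L^∨`. -/
noncomputable def iPerpDual (d : ℕ) (I : Submodule ℤ (Fin 21 → ℤ)) : AddSubgroup (Fin 21 → ℚ) :=
  orthoWithin (bilinK3Q d) (dualK3 d) (castMap '' (I : Set (Fin 21 → ℤ)))

/-- `(I^⊥_{L^∨})^⊥_{L^∨}`. -/
noncomputable def iPerpPerpDual (d : ℕ) (I : Submodule ℤ (Fin 21 → ℤ)) : AddSubgroup (Fin 21 → ℚ) :=
  orthoWithin (bilinK3Q d) (dualK3 d) (iPerpDual d I : Set (Fin 21 → ℚ))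

/-- The finite group `H_I = (I^⊥_{L^∨})^⊥_{L^∨} / I` measuring the imprimitivity of `I`. -/
def imprimitivityGroup (d : ℕ) (I : Submodule ℤ (Fin 21 → ℤ)) : Type :=
  ↥(iPerpPerpDual d I) ⧸
    (AddSubgroup.map castMap.toAddMonoidHom I.toAddSubgroup).addSubgroupOf (iPerpPerpDual d I)

noncomputable instance (d : ℕ) (I : Submodule ℤ (Fin 21 → ℤ)) : AddCommGroup (imprimitivityGroup d I) :=
  inferInstanceAs (AddCommGroup (↥(iPerpPerpDual d I) ⧸
    (AddSubgroup.map castMap.toAddMonoidHom I.toAddSubgroup).addSubgroupOf (iPerpPerpDual d I)))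

/-- `I^⊥_L`: the orthogonal complement of `I` inside the lattice `L = L_{2d}` itself. -/
def iPerpLat (d : ℕ) (I : Submodule ℤ (Fin 21 → ℤ)) : AddSubgroup (Fin 21 → ℤ) where
  carrier := {v | ∀ w ∈ I, bilinK3 d v w = 0}
  add_mem' := by
    intro a b ha hb y hy
    rw [map_add, LinearMap.add_apply, ha y hy, hb y hy, add_zero]
  zero_mem' := by intro y hy; simp
  neg_mem' := by
    intro x hx y hy
    rw [map_neg, LinearMap.neg_apply, hx y hy, neg_zero]

/-- The even lattice `K(F) = I^⊥_L / I` of rank 17 associated to the 1-cusp represented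
by `I` (as an abelian group; being an abelian group it is canonically a `ℤ`-module). -/
def cuspLattice (d : ℕ) (I : Submodule ℤ (Fin 21 → ℤ)) : Type :=
  ↥(iPerpLat d I) ⧸ I.toAddSubgroup.addSubgroupOf (iPerpLat d I)

instance (d : ℕ) (I : Submodule ℤ (Fin 21 → ℤ)) : AddCommGroup (cuspLattice d I) :=
  inferInstanceAs (AddCommGroup
    (↥(iPerpLat d I) ⧸ I.toAddSubgroup.addSubgroupOf (iPerpLat d I)))

/-- The image of a lattice `M` in `ℚ ⊗[ℤ] M`, as an additive subgroup. -/
noncomputable def latticeImage (M : Type*) [AddCommGroup M] [Module ℤ M] :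
    AddSubgroup (ℚ ⊗[ℤ] M) :=
  (TensorProduct.mk ℤ ℚ M 1).toAddMonoidHom.range

/-- The dual lattice `M^∨ ⊆ ℚ ⊗[ℤ] M` of a lattice `M` with respect to the rational
extension `BQ` of its bilinear form. -/
noncomputable def dualLattice (M : Type*) [AddCommGroup M] [Module ℤ M]
    (BQ : (ℚ ⊗[ℤ] M) →ₗ[ℚ] (ℚ ⊗[ℤ] M) →ₗ[ℚ] ℚ) : AddSubgroup (ℚ ⊗[ℤ] M) :=
  dualAddSubgroup BQ (latticeImage M)

/-- The discriminant group `D_M = M^∨ / M` of a lattice `M`, computed with respect to the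
rational extension `BQ` of its bilinear form. -/
noncomputable def DiscriminantGroup (M : Type*) [AddCommGroup M] [Module ℤ M]
    (BQ : (ℚ ⊗[ℤ] M) →ₗ[ℚ] (ℚ ⊗[ℤ] M) →ₗ[ℚ] ℚ) : Type _ :=
  ↥(dualLattice M BQ) ⧸ (latticeImage M).addSubgroupOf (dualLattice M BQ)

noncomputable instance (M : Type*) [AddCommGroup M] [Module ℤ M]
    (BQ : (ℚ ⊗[ℤ] M) →ₗ[ℚ] (ℚ ⊗[ℤ] M) →ₗ[ℚ] ℚ) :
    AddCommGroup (DiscriminantGroup M BQ) :=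
  inferInstanceAs (AddCommGroup
    (↥(dualLattice M BQ) ⧸ (latticeImage M).addSubgroupOf (dualLattice M BQ)))

/-- The inverse of the Gram matrix of `E8(−1)`. -/
def e8negInv : Matrix (Fin 8) (Fin 8) ℤ :=
  !![-4, -7, -10, -8, -6, -4, -2, -5;
     -7, -14, -20, -16, -12, -8, -4, -10;
     -10, -20, -30, -24, -18, -12, -6, -15;
     -8, -16, -24, -20, -15, -10, -5, -12;
     -6, -12, -18, -15, -12, -8, -4, -9;
     -4, -8, -12, -10, -8, -6, -3, -6;
     -2, -4, -6, -5, -4, -3, -2, -3;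
     -5, -10, -15, -12, -9, -6, -3, -8]

/-- The inverse of the Gram matrix of the unimodular part of `L_{2d}`, extended by zero to the
index `0`. -/
def unimodularInv : Matrix (Fin 21) (Fin 21) ℤ := fun i j =>
  if (i : ℕ) < 5 ∧ (j : ℕ) < 5 then gramK3 0 i j
  else if 5 ≤ (i : ℕ) ∧ (i : ℕ) ≤ 12 ∧ 5 ≤ (j : ℕ) ∧ (j : ℕ) ≤ 12 then
    e8negInv (Fin.ofNat 8 ((i : ℕ) - 5)) (Fin.ofNat 8 ((j : ℕ) - 5))
  else if 13 ≤ (i : ℕ) ∧ 13 ≤ (j : ℕ) then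
    e8negInv (Fin.ofNat 8 ((i : ℕ) - 13)) (Fin.ofNat 8 ((j : ℕ) - 13))
  else 0

theorem gramK3_zero_mul_unimodularInv (i j : Fin 21) :
    ∑ k, gramK3 0 i k * unimodularInv k j = if i = j ∧ i ≠ 0 then 1 else 0 := by
  revert i j
  decide +kernel

theorem gramK3_zero_symm (i j : Fin 21) : gramK3 0 i j = gramK3 0 j i := by
  have h : ∀ i j, gramK3 0 i j - gramK3 0 j i = 0 := by decide +kernel
  exact sub_eq_zero.mp (h i j)

theorem unimodularInv_symm (i j : Fin 21) : unimodularInv i j = unimodularInv j i := by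
  have h : ∀ i j, unimodularInv i j - unimodularInv j i = 0 := by decide +kernel
  exact sub_eq_zero.mp (h i j)

theorem unimodularInv_zero (j : Fin 21) : unimodularInv 0 j = 0 := by
  revert j
  decide +kernel

theorem gramK3_zero_even_diag (i : Fin 21) : Even (gramK3 0 i i) := by
  revert i
  decide +kernel

theorem gramK3_eq (d : ℕ) (i j : Fin 21) :
    gramK3 d i j = (if i = 0 ∧ j = 0 then -(2 * (d : ℤ)) else 0) + gramK3 0 i j := by
  by_cases h : i = 0 ∧ j = 0
  · obtain ⟨rfl, rfl⟩ := h
    change -(2 * (d : ℤ)) = -(2 * (d : ℤ)) + -(2 * ((0 : ℕ) : ℤ))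
    simp
  · have h' : ¬ ((i : ℕ) = 0 ∧ (j : ℕ) = 0) := by
      exact fun hij => h ⟨Fin.ext hij.1, Fin.ext hij.2⟩
    simp only [gramK3, h, h', if_false, zero_add]

theorem castMap_apply (v : Fin 21 → ℤ) (i : Fin 21) : castMap v i = (v i : ℚ) := rfl

theorem bilinK3Q_apply (d : ℕ) (x y : Fin 21 → ℚ) :
    bilinK3Q d x y =
      -(2 * (d : ℚ)) * x 0 * y 0 + ∑ i, ∑ j, x i * y j * (gramK3 0 i j : ℚ) := by
  have h0 : ∀ i j : Fin 21, x i * (y j * ((if i = 0 ∧ j = 0 then -(2 * (d : ℤ)) else 0 : ℤ) : ℚ))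
      = if i = 0 then (if j = 0 then -(2 * (d : ℚ)) * x 0 * y 0 else 0) else 0 := by
    intro i j
    by_cases hi : i = 0 <;> by_cases hj : j = 0 <;> simp [hi, hj]
    ring
  simp only [bilinK3Q, Matrix.toLinearMap₂'_apply, Matrix.map_apply, smul_eq_mul, gramK3_eq d,
    Int.cast_add, mul_add, Finset.sum_add_distrib, h0, mul_assoc]
  simp

theorem bilinK3Q_symm (d : ℕ) (x y : Fin 21 → ℚ) : bilinK3Q d x y = bilinK3Q d y x := by
  rw [bilinK3Q_apply, bilinK3Q_apply, Finset.sum_comm]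
  congr 1
  · ring
  · refine Finset.sum_congr rfl fun i _ => Finset.sum_congr rfl fun j _ => ?_
    rw [gramK3_zero_symm]
    ring

theorem bilinK3Q_castMap (d : ℕ) (v w : Fin 21 → ℤ) :
    bilinK3Q d (castMap v) (castMap w) = (bilinK3 d v w : ℚ) := by
  simp [bilinK3Q, bilinK3, Matrix.toLinearMap₂'_apply, castMap_apply]

theorem bilinK3Q_castMap_single (d : ℕ) (x : Fin 21 → ℚ) (j : Fin 21) :
    bilinK3Q d x (castMap (Pi.single j 1)) =
      (if j = 0 then -(2 * (d : ℚ)) * x 0 else 0) + ∑ i, x i * (gramK3 0 i j : ℚ) := by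
  have h : ∀ k, castMap (Pi.single j 1) k = if k = j then 1 else 0 := by
    intro k
    rw [castMap_apply, Pi.single_apply]
    split_ifs <;> simp
  rw [bilinK3Q_apply]
  congr 1
  · rw [h]
    simp [eq_comm]
  · refine Finset.sum_congr rfl fun i _ => ?_
    simp [h]

theorem sum_gramK3_mul_unimodularInv (x : Fin 21 → ℚ) (i : Fin 21) :
    ∑ j, (∑ k, x k * (gramK3 0 k j : ℚ)) * (unimodularInv j i : ℚ) =
      if i = 0 then 0 else x i := by
  simp only [Finset.sum_mul]
  rw [Finset.sum_comm]
  simp only [mul_assoc, ← Finset.mul_sum]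
  have h : ∀ k, ∑ j, (gramK3 0 k j : ℚ) * (unimodularInv j i : ℚ) =
      if k = i ∧ k ≠ 0 then 1 else 0 := by
    intro k
    exact_mod_cast gramK3_zero_mul_unimodularInv k i
  simp only [h]
  by_cases hi : i = 0
  · simp +contextual [hi]
  · rw [Finset.sum_eq_single i] <;> simp +contextual [hi]

theorem coord_eq_sum_bilinK3Q (d : ℕ) (x : Fin 21 → ℚ) (i : Fin 21) (hi : i ≠ 0) :
    x i = ∑ j, bilinK3Q d x (castMap (Pi.single j 1)) * (unimodularInv j i : ℚ) := by
  have h := sum_gramK3_mul_unimodularInv x i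
  rw [if_neg hi] at h
  rw [← h]
  refine Finset.sum_congr rfl fun j _ => ?_
  rw [bilinK3Q_castMap_single]
  by_cases hj : j = 0
  · simp [hj, unimodularInv_zero]
  · simp [hj]

theorem bilinK3Q_single_zero (d : ℕ) (x : Fin 21 → ℚ) :
    bilinK3Q d x (castMap (Pi.single 0 1)) = -(2 * (d : ℚ)) * x 0 := by
  have h : ∀ i, gramK3 0 i 0 = 0 := by decide +kernel
  simp [bilinK3Q_castMap_single, h]

theorem exists_int_of_mem_dualK3 {d : ℕ} {x : Fin 21 → ℚ} (hx : x ∈ dualK3 d)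
    (v : Fin 21 → ℤ) : ∃ k : ℤ, bilinK3Q d x (castMap v) = k :=
  hx _ ⟨v, rfl⟩

theorem castMap_mem_dualK3 (d : ℕ) (v : Fin 21 → ℤ) : castMap v ∈ dualK3 d := by
  rintro _ ⟨w, rfl⟩
  exact ⟨_, bilinK3Q_castMap d v w⟩

theorem exists_int_coord_zero {d : ℕ} {x : Fin 21 → ℚ} (hx : x ∈ dualK3 d) :
    ∃ k : ℤ, 2 * d * x 0 = k := by
  obtain ⟨k, hk⟩ := exists_int_of_mem_dualK3 hx (Pi.single 0 1)
  refine ⟨-k, ?_⟩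
  rw [bilinK3Q_single_zero] at hk
  push_cast
  linarith

/-- Every element of `L^∨` is a rational multiple of the generator of `⟨−2d⟩` plus an element of
the unimodular part. -/
theorem exists_eq_smul_single_add {d : ℕ} {x : Fin 21 → ℚ} (hx : x ∈ dualK3 d) :
    ∃ v : Fin 21 → ℤ, v 0 = 0 ∧ x = x 0 • castMap (Pi.single 0 1) + castMap v := by
  choose f hf using exists_int_of_mem_dualK3 hx
  refine ⟨fun i => if i = 0 then 0 else ∑ j, f (Pi.single j 1) * unimodularInv j i, by simp, ?_⟩
  funext i
  by_cases hi : i = 0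
  · subst hi
    simp [castMap_apply]
  · rw [Pi.add_apply, castMap_apply, coord_eq_sum_bilinK3Q d x i hi]
    simp [castMap_apply, hi, hf]

theorem bilinK3Q_smul_single_add (d : ℕ) (a b : ℚ) {v w : Fin 21 → ℤ} (hv : v 0 = 0)
    (hw : w 0 = 0) :
    bilinK3Q d (a • castMap (Pi.single 0 1) + castMap v)
      (b • castMap (Pi.single 0 1) + castMap w) = -(2 * d * a * b) + bilinK3 d v w := by
  simp only [map_add, map_smul, LinearMap.add_apply, LinearMap.smul_apply, bilinK3Q_single_zero,
    bilinK3Q_castMap, bilinK3Q_symm d (castMap (Pi.single 0 1)) (castMap w), castMap_apply, hv, hw]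
  simp
  ring

theorem even_sum_sum_of_symm {ι : Type*} [DecidableEq ι] (s : Finset ι) (f : ι → ι → ℤ)
    (hsymm : ∀ i j, f i j = f j i) (hdiag : ∀ i, Even (f i i)) :
    Even (∑ i ∈ s, ∑ j ∈ s, f i j) := by
  induction s using Finset.induction_on with
  | empty => simp
  | insert a s ha ih =>
    simp only [Finset.sum_insert ha, Finset.sum_add_distrib]
    have h : ∑ i ∈ s, f i a = ∑ i ∈ s, f a i := Finset.sum_congr rfl fun i _ => hsymm i a
    rw [h]
    obtain ⟨p, hp⟩ := hdiag a
    obtain ⟨q, hq⟩ := ih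
    exact ⟨p + q + ∑ i ∈ s, f a i, by rw [hp, hq]; ring⟩

theorem bilinK3_self_even (d : ℕ) (v : Fin 21 → ℤ) : Even (bilinK3 d v v) := by
  have h : bilinK3 d v v = -(2 * (d : ℤ)) * v 0 * v 0 + ∑ i, ∑ j, v i * v j * gramK3 0 i j := by
    have := bilinK3Q_apply d (castMap v) (castMap v)
    simp only [bilinK3Q_castMap, castMap_apply] at this
    exact_mod_cast this
  rw [h]
  refine Even.add ⟨-d * v 0 * v 0, by ring⟩ (even_sum_sum_of_symm _ _ ?_ ?_)
  · intro i j
    rw [gramK3_zero_symm]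
    ring
  · intro i
    exact (gramK3_zero_even_diag i).mul_left _

theorem exists_mem_dualK3 {d : ℕ} (hd : 0 < d) (φ : (Fin 21 → ℤ) →ₗ[ℤ] ℤ) :
    ∃ x ∈ dualK3 d, ∀ v, bilinK3Q d x (castMap v) = φ v := by
  have hd' : (d : ℚ) ≠ 0 := by positivity
  set f : Fin 21 → ℚ := fun j => φ (Pi.single j 1) with hf
  set x : Fin 21 → ℚ := fun i => (if i = 0 then -f 0 / (2 * d) else 0) +
    ∑ k, f k * (unimodularInv k i : ℚ) with hx
  have hx0 : x 0 = -f 0 / (2 * d) := by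
    simp [hx, unimodularInv_symm _ 0, unimodularInv_zero]
  have hG0 : ∀ j, gramK3 0 0 j = 0 := by decide +kernel
  have hbasis : ∀ j, bilinK3Q d x (castMap (Pi.single j 1)) = f j := by
    intro j
    have h1 : ∑ i, x i * (gramK3 0 i j : ℚ) = if j = 0 then 0 else f j := by
      have h2 : ∀ k, ∑ i, (unimodularInv k i : ℚ) * (gramK3 0 i j : ℚ) =
          if j = k ∧ j ≠ 0 then 1 else 0 := by
        intro k
        have := gramK3_zero_mul_unimodularInv j k
        simp only [gramK3_zero_symm j, unimodularInv_symm _ k] at this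
        simp only [mul_comm (unimodularInv k _ : ℚ)]
        exact_mod_cast this
      simp only [hx, add_mul, Finset.sum_add_distrib, Finset.sum_mul]
      rw [Finset.sum_comm]
      simp only [mul_assoc, ← Finset.mul_sum, h2]
      by_cases hj : j = 0 <;> simp [hj, hG0]
    rw [bilinK3Q_castMap_single, h1]
    by_cases hj : j = 0
    · rw [if_pos hj, if_pos hj, hx0, hj]
      field_simp
      ring
    · simp [hj]
  have hall : ∀ v, bilinK3Q d x (castMap v) = φ v := by
    have : ((bilinK3Q d x).restrictScalars ℤ).comp castMap =
        (Int.castAddHom ℚ).toIntLinearMap.comp φ := by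
      refine (Pi.basisFun ℤ (Fin 21)).ext fun j => ?_
      simpa [hf] using hbasis j
    exact fun v => LinearMap.congr_fun this v
  refine ⟨x, ?_, hall⟩
  rintro _ ⟨v, rfl⟩
  exact ⟨_, hall v⟩

theorem exists_bilinK3Q_eq {d : ℕ} {x y : Fin 21 → ℚ} (hx : x ∈ dualK3 d)
    (hy : y ∈ dualK3 d) : ∃ s : ℤ, bilinK3Q d x y = -(2 * d * x 0 * y 0) + s := by
  obtain ⟨v, hv, hxv⟩ := exists_eq_smul_single_add hx
  obtain ⟨w, hw, hyw⟩ := exists_eq_smul_single_add hy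
  refine ⟨bilinK3 d v w, ?_⟩
  rw [← bilinK3Q_smul_single_add d _ _ hv hw, ← hxv, ← hyw]

theorem exists_bilinK3Q_self_eq {d : ℕ} {x : Fin 21 → ℚ} (hx : x ∈ dualK3 d) :
    ∃ s : ℤ, bilinK3Q d x x = -(2 * d * x 0 * x 0) + 2 * s := by
  obtain ⟨v, hv, hxv⟩ := exists_eq_smul_single_add hx
  obtain ⟨s, hs⟩ := bilinK3_self_even d v
  refine ⟨s, ?_⟩
  have h := bilinK3Q_smul_single_add d (x 0) (x 0) hv hv
  rw [← hxv, hs] at h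
  rw [h]
  push_cast
  ring

theorem exists_castMap_eq {d : ℕ} {x : Fin 21 → ℚ} (hx : x ∈ dualK3 d)
    {n : ℤ} (hn : x 0 = n) : ∃ v, castMap v = x := by
  obtain ⟨v, hv, hxv⟩ := exists_eq_smul_single_add hx
  refine ⟨n • Pi.single 0 1 + v, ?_⟩
  rw [hxv, map_add, map_smul, hn, Int.cast_smul_eq_zsmul]

theorem isTorsionFree_quotient {M : Type*} [AddCommGroup M] (A : Submodule ℤ M)
    (hA : ∀ (v : M) (k : ℤ), k ≠ 0 → k • v ∈ A → v ∈ A) : Module.IsTorsionFree ℤ (M ⧸ A) where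
  isSMulRegular k hk := by
    intro a b hab
    obtain ⟨v, rfl⟩ := A.mkQ_surjective a
    obtain ⟨w, rfl⟩ := A.mkQ_surjective b
    have h : k • (v - w) ∈ A := by
      rw [smul_sub]
      exact (Submodule.Quotient.eq A).mp hab
    exact (Submodule.Quotient.eq A).mpr (hA _ k hk.ne_zero h)

theorem exists_sub_smul_mem_of_forall_dvd {M : Type*} [AddCommGroup M] [Module.Finite ℤ M]
    (A : Submodule ℤ M) (hA : ∀ (v : M) (k : ℤ), k ≠ 0 → k • v ∈ A → v ∈ A) (c : ℤ) (v : M)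
    (h : ∀ φ : M →ₗ[ℤ] ℤ, (∀ w ∈ A, φ w = 0) → c ∣ φ v) : ∃ u, v - c • u ∈ A := by
  have := isTorsionFree_quotient A hA
  have : Module.Free ℤ (M ⧸ A) := Module.free_of_finite_type_torsion_free'
  let b := Module.Free.chooseBasis ℤ (M ⧸ A)
  have hb : ∀ i, c ∣ b.repr (A.mkQ v) i := fun i =>
    h ((b.coord i).comp A.mkQ) fun w hw => by
      simp [(Submodule.Quotient.mk_eq_zero A).mpr hw]
  choose f hf using hb
  obtain ⟨u, hu⟩ := A.mkQ_surjective (∑ i, f i • b i)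
  refine ⟨u, (Submodule.Quotient.mk_eq_zero A).mp ?_⟩
  change A.mkQ (v - c • u) = 0
  rw [map_sub, map_smul, hu, sub_eq_zero, ← b.sum_repr (A.mkQ v), Finset.smul_sum]
  exact Finset.sum_congr rfl fun i _ => by rw [hf, mul_smul]

theorem exists_extend_of_primitive {M : Type*} [AddCommGroup M] [Module.Finite ℤ M]
    (A : Submodule ℤ M) (hA : ∀ (v : M) (k : ℤ), k ≠ 0 → k • v ∈ A → v ∈ A)
    (φ : A →ₗ[ℤ] ℤ) : ∃ ψ : M →ₗ[ℤ] ℤ, ∀ a : A, ψ a = φ a := by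
  have := isTorsionFree_quotient A hA
  have : Module.Free ℤ (M ⧸ A) := Module.free_of_finite_type_torsion_free'
  obtain ⟨g, hg⟩ := A.mkQ.exists_rightInverse_of_surjective A.range_mkQ
  have hmem : ∀ v, v - g (A.mkQ v) ∈ A := fun v =>
    (Submodule.Quotient.mk_eq_zero A).mp <| by
      change A.mkQ (v - g (A.mkQ v)) = 0
      rw [map_sub, show A.mkQ (g (A.mkQ v)) = A.mkQ v from LinearMap.congr_fun hg _, sub_self]
  refine ⟨φ.comp ((LinearMap.id - g.comp A.mkQ).codRestrict A hmem), fun a => ?_⟩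
  rw [LinearMap.comp_apply]
  congr 1
  ext
  simp [(Submodule.Quotient.mk_eq_zero A).mpr a.2]

section IsotropicPlane

variable {d : ℕ} {I : Submodule ℤ (Fin 21 → ℤ)}

theorem mem_iPerpDual {x : Fin 21 → ℚ} :
    x ∈ iPerpDual d I ↔ x ∈ dualK3 d ∧ ∀ w ∈ I, bilinK3Q d x (castMap w) = 0 :=
  and_congr_right fun _ => Set.forall_mem_image

theorem mem_iPerpPerpDual {x : Fin 21 → ℚ} :
    x ∈ iPerpPerpDual d I ↔ x ∈ dualK3 d ∧ ∀ p ∈ iPerpDual d I, bilinK3Q d x p = 0 :=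
  Iff.rfl

theorem castMap_mem_iPerpDual {v : Fin 21 → ℤ} :
    castMap v ∈ iPerpDual d I ↔ v ∈ iPerpLat d I := by
  rw [mem_iPerpDual, and_iff_right (castMap_mem_dualK3 d v)]
  simp only [bilinK3Q_castMap, Int.cast_eq_zero]
  rfl

theorem exists_mem_iPerpDual (hd : 0 < d) (φ : (Fin 21 → ℤ) →ₗ[ℤ] ℤ) (hφ : ∀ w ∈ I, φ w = 0) :
    ∃ p ∈ iPerpDual d I, ∀ v, bilinK3Q d p (castMap v) = φ v := by
  obtain ⟨p, hp, h⟩ := exists_mem_dualK3 hd φ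
  exact ⟨p, mem_iPerpDual.mpr ⟨hp, fun w hw => by rw [h, hφ w hw, Int.cast_zero]⟩, h⟩

theorem exists_sub_smul_mem (hd : 0 < d)
    (hprim : ∀ (v : Fin 21 → ℤ) (k : ℤ), k ≠ 0 → k • v ∈ I → v ∈ I) (c : ℤ) (v : Fin 21 → ℤ)
    (h : ∀ p ∈ iPerpDual d I, ∃ k : ℤ, bilinK3Q d p (castMap v) = c * k) :
    ∃ u, v - c • u ∈ I := by
  refine exists_sub_smul_mem_of_forall_dvd I hprim c v fun φ hφ => ?_
  obtain ⟨p, hp, hpφ⟩ := exists_mem_iPerpDual hd φ hφ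
  obtain ⟨k, hk⟩ := h p hp
  rw [hpφ] at hk
  exact ⟨k, by exact_mod_cast hk⟩

theorem mem_of_castMap_mem_iPerpPerpDual (hd : 0 < d)
    (hprim : ∀ (v : Fin 21 → ℤ) (k : ℤ), k ≠ 0 → k • v ∈ I → v ∈ I) {v : Fin 21 → ℤ}
    (hv : castMap v ∈ iPerpPerpDual d I) : v ∈ I := by
  obtain ⟨u, hu⟩ := exists_sub_smul_mem hd hprim 0 v fun p hp =>
    ⟨0, by rw [bilinK3Q_symm, (mem_iPerpPerpDual.mp hv).2 p hp]; simp⟩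
  simpa using hu

theorem exists_castMap_eq_two_mul_smul {x : Fin 21 → ℚ} (hx : x ∈ dualK3 d) :
    ∃ v, castMap v = (2 * d : ℤ) • x := by
  obtain ⟨k, hk⟩ := exists_int_coord_zero hx
  refine exists_castMap_eq (n := k) (AddSubgroup.zsmul_mem _ hx _) ?_
  rw [← hk]
  simp

theorem exists_mem_castMap_eq (hd : 0 < d)
    (hprim : ∀ (v : Fin 21 → ℤ) (k : ℤ), k ≠ 0 → k • v ∈ I → v ∈ I) {x : Fin 21 → ℚ}
    (hx : x ∈ iPerpPerpDual d I) {n : ℤ} (hn : x 0 = n) : ∃ w ∈ I, castMap w = x := by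
  obtain ⟨v, rfl⟩ := exists_castMap_eq (mem_iPerpPerpDual.mp hx).1 hn
  exact ⟨v, mem_of_castMap_mem_iPerpPerpDual hd hprim hx, rfl⟩

theorem iPerpPerpDual_le_iPerpDual (hd : 0 < d)
    (hprim : ∀ (v : Fin 21 → ℤ) (k : ℤ), k ≠ 0 → k • v ∈ I → v ∈ I)
    (hisot : ∀ v ∈ I, ∀ w ∈ I, bilinK3 d v w = 0) : iPerpPerpDual d I ≤ iPerpDual d I := by
  intro x hx
  refine mem_iPerpDual.mpr ⟨(mem_iPerpPerpDual.mp hx).1, fun w hw => ?_⟩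
  obtain ⟨v, hv⟩ := exists_castMap_eq_two_mul_smul (mem_iPerpPerpDual.mp hx).1
  have hvI : v ∈ I := mem_of_castMap_mem_iPerpPerpDual hd hprim
    (hv ▸ AddSubgroup.zsmul_mem _ hx _)
  have h := bilinK3Q_castMap d v w
  rw [hv, hisot v hvI w hw, map_zsmul, LinearMap.smul_apply, Int.cast_zero] at h
  exact (smul_eq_zero.mp h).resolve_left (by positivity)

/-- If `H_I` is cyclic of order `N`, then `(I^⊥)^⊥` is generated by `I` and an element `x` whose
image in `D_L` has order `N`. -/
theorem exists_generator (hd : 0 < d)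
    (hprim : ∀ (v : Fin 21 → ℤ) (k : ℤ), k ≠ 0 → k • v ∈ I → v ∈ I) {N : ℕ}
    (e : imprimitivityGroup d I ≃+ ZMod N) :
    ∃ x ∈ iPerpPerpDual d I, ∃ k : ℤ, 2 * d * x 0 = k ∧
      (∀ n : ℤ, (N : ℤ) ∣ n ↔ (2 * d : ℤ) ∣ n * k) ∧
      ∀ y ∈ iPerpPerpDual d I, ∃ n : ℤ, ∃ w ∈ I, y = n • x + castMap w := by
  have hd' : (d : ℚ) ≠ 0 := by positivity
  let S := (AddSubgroup.map castMap.toAddMonoidHom I.toAddSubgroup).addSubgroupOf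
    (iPerpPerpDual d I)
  obtain ⟨⟨x, hx⟩, hxe⟩ := QuotientAddGroup.mk_surjective (s := S) (e.symm 1)
  let q : iPerpPerpDual d I →+ imprimitivityGroup d I := QuotientAddGroup.mk' S
  have hq : ∀ y : iPerpPerpDual d I, q y = 0 ↔ ∃ w ∈ I, castMap w = y := fun y =>
    QuotientAddGroup.eq_zero_iff (N := S) y
  have hqx : e (q ⟨x, hx⟩) = 1 := by
    rw [show q ⟨x, hx⟩ = e.symm 1 from hxe, e.apply_symm_apply]
  obtain ⟨k, hk⟩ := exists_int_coord_zero (mem_iPerpPerpDual.mp hx).1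
  refine ⟨x, hx, k, hk, fun n => ?_, fun y hy => ?_⟩
  · have h1 : (N : ℤ) ∣ n ↔ q (n • ⟨x, hx⟩) = 0 := by
      rw [← e.map_eq_zero_iff, map_zsmul, map_zsmul, hqx, zsmul_one,
        ZMod.intCast_zmod_eq_zero_iff_dvd]
    rw [h1, hq]
    constructor
    · rintro ⟨w, -, hw⟩
      refine ⟨w 0, ?_⟩
      have := congrFun hw 0
      rw [castMap_apply] at this
      simp at this
      have h2 : (n * k : ℚ) = 2 * d * w 0 := by
        rw [this, ← hk]
        ring
      exact_mod_cast h2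
    · rintro ⟨r, hr⟩
      have hr' : (n * k : ℚ) = 2 * d * r := by exact_mod_cast hr
      refine exists_mem_castMap_eq (n := r) hd hprim (n • (⟨x, hx⟩ : iPerpPerpDual d I)).2 ?_
      rw [← hk] at hr'
      simp
      have h3 : (2 * d : ℚ) ≠ 0 := by positivity
      apply mul_left_cancel₀ h3
      linarith
  · obtain ⟨n, hn⟩ := ZMod.intCast_surjective (e (q ⟨y, hy⟩))
    have h1 : q (⟨y, hy⟩ - n • ⟨x, hx⟩) = 0 := by
      rw [← e.map_eq_zero_iff, map_sub, map_sub, map_zsmul, map_zsmul, hqx, ← hn, zsmul_one,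
        sub_self]
    obtain ⟨w, hw, hwy⟩ := (hq _).mp h1
    refine ⟨n, w, hw, ?_⟩
    rw [hwy]
    simp

theorem dvd_coord_zero {N : ℕ} {x p : Fin 21 → ℚ} {k a : ℤ}
    (hx : x ∈ iPerpPerpDual d I) (hp : p ∈ iPerpDual d I) (hk : 2 * d * x 0 = k)
    (hN : ∀ n : ℤ, (N : ℤ) ∣ n ↔ (2 * d : ℤ) ∣ n * k) (ha : 2 * d * p 0 = a) :
    (N : ℤ) ∣ a := by
  obtain ⟨s, hs⟩ := exists_bilinK3Q_eq (mem_iPerpPerpDual.mp hx).1 (mem_iPerpDual.mp hp).1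
  rw [(mem_iPerpPerpDual.mp hx).2 p hp] at hs
  refine (hN a).mpr ⟨s, ?_⟩
  have : (a * k : ℚ) = 2 * d * s := by
    rw [← ha, ← hk]
    linear_combination (2 * d : ℚ) * hs
  exact_mod_cast this

theorem exists_coord_zero_eq (hd : 0 < d)
    (hprim : ∀ (v : Fin 21 → ℤ) (k : ℤ), k ≠ 0 → k • v ∈ I → v ∈ I)
    (hisot : ∀ v ∈ I, ∀ w ∈ I, bilinK3 d v w = 0) {N : ℤ}
    (hN : ∀ z ∈ iPerpPerpDual d I, ∃ r : ℤ, N * z 0 = r) :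
    ∃ p ∈ iPerpDual d I, 2 * d * p 0 = N := by
  have hd' : (d : ℚ) ≠ 0 := by positivity
  let S : AddSubgroup ℤ :=
    { carrier := {a | ∃ p ∈ iPerpDual d I, 2 * d * p 0 = a}
      zero_mem' := ⟨0, zero_mem _, by simp⟩
      add_mem' := by
        rintro a b ⟨p, hp, ha⟩ ⟨q, hq, hb⟩
        exact ⟨p + q, add_mem hp hq, by push_cast; rw [← ha, ← hb, Pi.add_apply]; ring⟩
      neg_mem' := by
        rintro a ⟨p, hp, ha⟩
        exact ⟨-p, neg_mem hp, by push_cast; rw [← ha, Pi.neg_apply]; ring⟩ }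
  obtain ⟨c, hc⟩ := Int.subgroup_cyclic S
  have hmem : ∀ a, a ∈ S ↔ c ∣ a := fun a => by
    rw [hc, ← AddSubgroup.zmultiples_eq_closure, Int.mem_zmultiples_iff]
  set e₀ : Fin 21 → ℤ := Pi.single 0 1 with he₀
  obtain ⟨u, hu⟩ := exists_sub_smul_mem hd hprim c e₀ fun p hp => by
    obtain ⟨a, ha⟩ := exists_int_coord_zero (mem_iPerpDual.mp hp).1
    obtain ⟨k, rfl⟩ := (hmem a).mp ⟨p, hp, ha⟩
    refine ⟨-k, ?_⟩
    rw [bilinK3Q_single_zero]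
    push_cast at ha ⊢
    linarith
  set w := e₀ - c • u with hw
  have hz0 : castMap w 0 = 1 - c * u 0 := by simp [castMap_apply, hw, he₀]
  have hBw : ∀ v, bilinK3Q d (castMap w) (castMap v) =
      -(2 * d * v 0) - c * bilinK3 d u v := by
    intro v
    rw [hw, map_sub, map_smul, map_sub, LinearMap.sub_apply, map_zsmul,
      LinearMap.smul_apply, bilinK3Q_symm, bilinK3Q_single_zero, castMap_apply, bilinK3Q_castMap]
    simp
  have hcd : ∃ r : ℤ, (2 * d : ℚ) = c * r := by
    have h := bilinK3Q_castMap d w w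
    rw [hisot w hu w hu, hBw, ← castMap_apply, hz0] at h
    refine ⟨2 * d * u 0 - bilinK3 d u w, ?_⟩
    push_cast at h ⊢
    linarith
  obtain ⟨r, hr⟩ := hcd
  have hc0 : (c : ℚ) ≠ 0 := by
    rintro h
    rw [h, zero_mul] at hr
    simp [hd'] at hr
  have hz : (c : ℚ)⁻¹ • castMap w ∈ iPerpPerpDual d I := by
    refine mem_iPerpPerpDual.mpr ⟨?_, fun p hp => ?_⟩
    · rintro _ ⟨v, rfl⟩
      refine ⟨-(r * v 0) - bilinK3 d u v, ?_⟩
      rw [map_smul, LinearMap.smul_apply, hBw, hr]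
      push_cast
      simp
      field_simp
    · rw [map_smul, LinearMap.smul_apply, bilinK3Q_symm, (mem_iPerpDual.mp hp).2 w hu, smul_zero]
  obtain ⟨s, hs⟩ := hN _ hz
  rw [Pi.smul_apply, hz0, smul_eq_mul] at hs
  refine (hmem N).mpr ⟨s + N * u 0, ?_⟩
  have : (N : ℚ) = c * (s + N * u 0) := by
    rw [← hs]
    field_simp
    ring
  exact_mod_cast this

end IsotropicPlane

theorem exists_eq_sq_mul {d N : ℕ} (hd : 0 < d) (hN : 0 < N) {k s : ℤ}
    (h : ∀ n : ℤ, (N : ℤ) ∣ n ↔ (2 * d : ℤ) ∣ n * k) (hs : k ^ 2 = 4 * d * s) :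
    ∃ m : ℕ, d = N ^ 2 * m ∧ ∃ t : ℤ, k = 2 * m * N * t ∧ IsCoprime t N := by
  have hN' : (N : ℤ) ≠ 0 := by positivity
  obtain ⟨g, hg⟩ : (N : ℤ) ∣ 2 * d := (h _).mpr (dvd_mul_right _ _)
  have hg0 : g ≠ 0 := by
    rintro rfl
    simp at hg
    omega
  obtain ⟨t, ht⟩ : g ∣ k := by
    obtain ⟨t, ht⟩ := (h N).mp dvd_rfl
    refine ⟨t, mul_left_cancel₀ hN' ?_⟩
    rw [ht, hg]
    ring
  have hcop : IsCoprime t N := by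
    rw [Int.isCoprime_iff_gcd_eq_one]
    obtain ⟨a, ha⟩ := Int.gcd_dvd_left t (N : ℤ)
    obtain ⟨b, hb⟩ := Int.gcd_dvd_right t (N : ℤ)
    set c : ℤ := (Int.gcd t N : ℤ) with hc
    have hNb : (N : ℤ) ∣ b := (h b).mpr ⟨a, by
      rw [ht, hg]
      linear_combination (b * g) * ha - g * a * hb⟩
    obtain ⟨q, hq⟩ := hNb
    have h1 : c * q = 1 := by
      apply mul_left_cancel₀ hN'
      linear_combination -hb - c * hq
    have h2 : c = 1 := Int.eq_one_of_dvd_one (by positivity) ⟨q, h1.symm⟩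
    rw [hc] at h2
    exact_mod_cast h2
  have h1 : g * t ^ 2 = 2 * N * s := by
    apply mul_left_cancel₀ hg0
    rw [ht] at hs
    linear_combination hs + 2 * s * hg
  obtain ⟨g', rfl⟩ : (N : ℤ) ∣ g :=
    (hcop.symm.pow_right (n := 2)).dvd_of_dvd_mul_right ⟨2 * s, by rw [h1]; ring⟩
  have h2 : g' * t ^ 2 = 2 * s := by
    apply mul_left_cancel₀ hN'
    linear_combination h1
  have h3 : Even g' := by
    by_contra hodd
    rw [Int.not_even_iff_odd] at hodd
    have ht2 : Even t := by
      have : Even (g' * t ^ 2) := ⟨s, by rw [h2]; ring⟩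
      rcases Int.even_mul.mp this with h | h
      · exact absurd h (Int.not_even_iff_odd.mpr hodd)
      · exact (Int.even_pow.mp h).1
    have hN2 : Even (N : ℤ) := by
      have : Even ((N : ℤ) * (N * g')) := ⟨d, by rw [← hg]; ring⟩
      rcases Int.even_mul.mp this with h | h
      · exact h
      · exact (Int.even_mul.mp h).resolve_right (Int.not_even_iff_odd.mpr hodd)
    have := hcop.isUnit_of_dvd' ht2.two_dvd hN2.two_dvd
    rw [Int.isUnit_iff] at this
    omega
  obtain ⟨m, rfl⟩ := h3
  have hdm : (d : ℤ) = N ^ 2 * m := by linarith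
  have hm : 0 ≤ m := by
    by_contra! hlt
    have : (N : ℤ) ^ 2 * m < 0 := mul_neg_of_pos_of_neg (by positivity) hlt
    omega
  lift m to ℕ using hm
  exact ⟨m, by exact_mod_cast hdm, t, by rw [ht]; ring, hcop⟩

theorem exists_smul_eq_one_tmul {M : Type*} [AddCommGroup M] (ξ : ℚ ⊗[ℤ] M) :
    ∃ n : ℤ, n ≠ 0 ∧ ∃ v : M, (n : ℚ) • ξ = (1 : ℚ) ⊗ₜ[ℤ] v := by
  induction ξ using TensorProduct.induction_on with
  | zero => exact ⟨1, one_ne_zero, 0, by simp⟩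
  | tmul q v =>
    refine ⟨q.den, by exact_mod_cast q.den_nz, q.num • v, ?_⟩
    rw [TensorProduct.tmul_smul, TensorProduct.smul_tmul', TensorProduct.smul_tmul', smul_eq_mul,
      Int.cast_natCast, Rat.den_mul_eq_num, zsmul_one]
  | add x y hx hy =>
    obtain ⟨n, hn, v, hv⟩ := hx
    obtain ⟨m, hm, w, hw⟩ := hy
    refine ⟨n * m, mul_ne_zero hn hm, m • v + n • w, ?_⟩
    rw [TensorProduct.tmul_add, TensorProduct.tmul_smul, TensorProduct.tmul_smul, ← hv, ← hw,
      smul_add, ← Int.cast_smul_eq_zsmul ℚ m, ← Int.cast_smul_eq_zsmul ℚ n, smul_smul, smul_smul]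
    push_cast
    rw [mul_comm (m : ℚ)]

theorem iPerpLat_primitive (d : ℕ) (I : Submodule ℤ (Fin 21 → ℤ)) (v : Fin 21 → ℤ) (k : ℤ)
    (hk : k ≠ 0) (hv : k • v ∈ iPerpLat d I) : v ∈ iPerpLat d I := by
  intro w hw
  have h := hv w hw
  rw [map_smul, LinearMap.smul_apply, smul_eq_mul] at h
  exact (mul_eq_zero.mp h).resolve_left hk

section CuspLattice

variable {d : ℕ} {I : Submodule ℤ (Fin 21 → ℤ)}

/-- The projection from `I^⊥_L` to `K = I^⊥_L / I`. -/
def toCuspLattice (d : ℕ) (I : Submodule ℤ (Fin 21 → ℤ)) : iPerpLat d I →+ cuspLattice d I :=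
  QuotientAddGroup.mk' (I.toAddSubgroup.addSubgroupOf (iPerpLat d I))

/-- The map from `I^⊥_L` to `ℚ ⊗ K`, where `K = I^⊥_L / I`. -/
noncomputable def toCuspLatticeQ (d : ℕ) (I : Submodule ℤ (Fin 21 → ℤ)) :
    iPerpLat d I →+ ℚ ⊗[ℤ] cuspLattice d I :=
  (TensorProduct.mk ℤ ℚ (cuspLattice d I) 1).toAddMonoidHom.comp (toCuspLattice d I)

theorem toCuspLatticeQ_eq_zero {v : iPerpLat d I} (hv : (v : Fin 21 → ℤ) ∈ I) :
    toCuspLatticeQ d I v = 0 := by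
  have h : toCuspLattice d I v = 0 := (QuotientAddGroup.eq_zero_iff v).mpr hv
  rw [toCuspLatticeQ, AddMonoidHom.comp_apply, h, map_zero]

theorem exists_toCuspLatticeQ (c : cuspLattice d I) :
    ∃ v, (1 : ℚ) ⊗ₜ[ℤ] c = toCuspLatticeQ d I v := by
  obtain ⟨v, rfl⟩ := QuotientAddGroup.mk_surjective c
  exact ⟨v, rfl⟩

theorem toCuspLatticeQ_mem (v : iPerpLat d I) :
    toCuspLatticeQ d I v ∈ latticeImage (cuspLattice d I) :=
  ⟨_, rfl⟩

theorem mem_latticeImage_iff {ξ : ℚ ⊗[ℤ] cuspLattice d I} :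
    ξ ∈ latticeImage (cuspLattice d I) ↔ ∃ v, ξ = toCuspLatticeQ d I v := by
  constructor
  · rintro ⟨c, rfl⟩
    exact exists_toCuspLatticeQ c
  · rintro ⟨v, rfl⟩
    exact toCuspLatticeQ_mem v

variable {BQK : (ℚ ⊗[ℤ] cuspLattice d I) →ₗ[ℚ] (ℚ ⊗[ℤ] cuspLattice d I) →ₗ[ℚ] ℚ}

theorem mem_dualLattice_iff {ξ : ℚ ⊗[ℤ] cuspLattice d I} :
    ξ ∈ dualLattice (cuspLattice d I) BQK ↔
      ∀ v, ∃ k : ℤ, BQK ξ (toCuspLatticeQ d I v) = k := by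
  constructor
  · exact fun h v => h _ (toCuspLatticeQ_mem v)
  · intro h y hy
    obtain ⟨v, rfl⟩ := mem_latticeImage_iff.mp hy
    exact h v

theorem eq_zero_of_forall_toCuspLatticeQ (hd : 0 < d)
    (hprim : ∀ (v : Fin 21 → ℤ) (k : ℤ), k ≠ 0 → k • v ∈ I → v ∈ I)
    (hB : ∀ v w, BQK (toCuspLatticeQ d I v) (toCuspLatticeQ d I w) =
      bilinK3Q d (castMap v) (castMap w))
    {ξ : ℚ ⊗[ℤ] cuspLattice d I} (hξ : ∀ w, BQK ξ (toCuspLatticeQ d I w) = 0) : ξ = 0 := by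
  obtain ⟨n, hn, c, hc⟩ := exists_smul_eq_one_tmul ξ
  obtain ⟨v, hv⟩ := exists_toCuspLatticeQ c
  rw [hv] at hc
  have hvI : (v : Fin 21 → ℤ) ∈ I := by
    refine mem_of_castMap_mem_iPerpPerpDual hd hprim
      (mem_iPerpPerpDual.mpr ⟨castMap_mem_dualK3 d _, fun p hp => ?_⟩)
    obtain ⟨w, hw⟩ := exists_castMap_eq_two_mul_smul (mem_iPerpDual.mp hp).1
    have hwP : w ∈ iPerpLat d I :=
      castMap_mem_iPerpDual.mp (hw ▸ AddSubgroup.zsmul_mem _ hp _)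
    have h := hB v ⟨w, hwP⟩
    rw [← hc, map_smul, LinearMap.smul_apply, hξ, smul_zero, hw, map_zsmul] at h
    exact (smul_eq_zero.mp h.symm).resolve_left (by positivity)
  rw [toCuspLatticeQ_eq_zero hvI] at hc
  exact (smul_eq_zero.mp hc).resolve_left (by exact_mod_cast hn)

theorem exists_represents_of_mem_iPerpDual (hd : 0 < d)
    (hB : ∀ v w, BQK (toCuspLatticeQ d I v) (toCuspLatticeQ d I w) =
      bilinK3Q d (castMap v) (castMap w))
    {p : Fin 21 → ℚ} (hp : p ∈ iPerpDual d I) :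
    ∃ ξ, ∀ w, BQK ξ (toCuspLatticeQ d I w) = bilinK3Q d p (castMap w) := by
  have hd' : (d : ℚ) ≠ 0 := by positivity
  obtain ⟨v, hv⟩ := exists_castMap_eq_two_mul_smul (mem_iPerpDual.mp hp).1
  have hvP : v ∈ iPerpLat d I := castMap_mem_iPerpDual.mp (hv ▸ AddSubgroup.zsmul_mem _ hp _)
  refine ⟨(2 * d : ℚ)⁻¹ • toCuspLatticeQ d I ⟨v, hvP⟩, fun w => ?_⟩
  rw [map_smul, LinearMap.smul_apply, hB, hv, map_zsmul, LinearMap.smul_apply, smul_eq_mul,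
    zsmul_eq_mul]
  push_cast
  field_simp

theorem exists_mem_iPerpDual_of_mem_dualLattice (hd : 0 < d)
    (hisot : ∀ v ∈ I, ∀ w ∈ I, bilinK3 d v w = 0)
    {ξ : ℚ ⊗[ℤ] cuspLattice d I} (hξ : ξ ∈ dualLattice (cuspLattice d I) BQK) :
    ∃ p ∈ iPerpDual d I, ∀ w : iPerpLat d I,
      BQK ξ (toCuspLatticeQ d I w) = bilinK3Q d p (castMap w) := by
  choose f hf using mem_dualLattice_iff.mp hξ
  let φ : AddSubgroup.toIntSubmodule (iPerpLat d I) →ₗ[ℤ] ℤ :=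
    (AddMonoidHom.mk' (M := iPerpLat d I) (G := ℤ) f fun a b => by
      have h : (f (a + b) : ℚ) = f a + f b := by
        rw [← hf, ← hf, ← hf, map_add, map_add]
      exact_mod_cast h).toIntLinearMap
  obtain ⟨ψ, hψ⟩ := exists_extend_of_primitive (AddSubgroup.toIntSubmodule (iPerpLat d I))
    (iPerpLat_primitive d I) φ
  have hψ' : ∀ w : iPerpLat d I, BQK ξ (toCuspLatticeQ d I w) = ψ w := fun w => by
    rw [hf, hψ w]
    rfl
  obtain ⟨p, hp, hpψ⟩ := exists_mem_iPerpDual (I := I) hd ψ fun w hw => by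
    have h := hψ' ⟨w, hisot w hw⟩
    rw [toCuspLatticeQ_eq_zero hw, map_zero] at h
    exact_mod_cast h.symm
  exact ⟨p, hp, fun w => by rw [hψ', hpψ]⟩

/-- An element of `K^∨` represented by `p ∈ I^⊥_{L^∨}` lies in `K` if and only if `p` is congruent
to an element of `I^⊥_L` modulo `(I^⊥)^⊥`. -/
theorem mem_latticeImage_iff_of_represents (hd : 0 < d)
    (hprim : ∀ (v : Fin 21 → ℤ) (k : ℤ), k ≠ 0 → k • v ∈ I → v ∈ I)
    (hB : ∀ v w, BQK (toCuspLatticeQ d I v) (toCuspLatticeQ d I w) =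
      bilinK3Q d (castMap v) (castMap w))
    {p : Fin 21 → ℚ} (hp : p ∈ iPerpDual d I) {ξ : ℚ ⊗[ℤ] cuspLattice d I}
    (hξ : ∀ w, BQK ξ (toCuspLatticeQ d I w) = bilinK3Q d p (castMap w)) :
    ξ ∈ latticeImage (cuspLattice d I) ↔
      ∃ v ∈ iPerpLat d I, p - castMap v ∈ iPerpPerpDual d I := by
  rw [mem_latticeImage_iff]
  constructor
  · rintro ⟨v, rfl⟩
    refine ⟨v, v.2, mem_iPerpPerpDual.mpr
      ⟨sub_mem (mem_iPerpDual.mp hp).1 (castMap_mem_dualK3 d _), fun q hq => ?_⟩⟩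
    obtain ⟨w, hw⟩ := exists_castMap_eq_two_mul_smul (mem_iPerpDual.mp hq).1
    have hwP : w ∈ iPerpLat d I := castMap_mem_iPerpDual.mp (hw ▸ AddSubgroup.zsmul_mem _ hq _)
    have h := hξ ⟨w, hwP⟩
    rw [hB, eq_comm, ← sub_eq_zero, ← LinearMap.sub_apply, ← map_sub, hw, map_zsmul] at h
    exact (smul_eq_zero.mp h).resolve_left (by positivity)
  · rintro ⟨v, hv, hpv⟩
    refine ⟨⟨v, hv⟩, sub_eq_zero.mp (eq_zero_of_forall_toCuspLatticeQ hd hprim hB fun w => ?_)⟩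
    rw [map_sub, LinearMap.sub_apply, hξ, hB, ← LinearMap.sub_apply, ← map_sub]
    exact (mem_iPerpPerpDual.mp hpv).2 _ (castMap_mem_iPerpDual.mpr w.2)

theorem nonempty_discriminantGroup_equiv (hd : 0 < d)
    (hprim : ∀ (v : Fin 21 → ℤ) (k : ℤ), k ≠ 0 → k • v ∈ I → v ∈ I)
    (hisot : ∀ v ∈ I, ∀ w ∈ I, bilinK3 d v w = 0)
    (hB : ∀ v w, BQK (toCuspLatticeQ d I v) (toCuspLatticeQ d I w) =
      bilinK3Q d (castMap v) (castMap w))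
    {p : Fin 21 → ℚ} (hp : p ∈ iPerpDual d I) {n : ℕ}
    (hgen : ∀ q ∈ iPerpDual d I, ∃ k : ℤ, ∃ v : Fin 21 → ℤ, q - k • p = castMap v)
    (hker : ∀ k : ℤ, (∃ v ∈ iPerpLat d I, k • p - castMap v ∈ iPerpPerpDual d I) ↔
      (n : ℤ) ∣ k) :
    Nonempty (DiscriminantGroup (cuspLattice d I) BQK ≃+ ZMod n) := by
  obtain ⟨ξ, hξ⟩ := exists_represents_of_mem_iPerpDual hd hB hp
  have hξk : ∀ (k : ℤ) w, BQK (k • ξ) (toCuspLatticeQ d I w) =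
      bilinK3Q d (k • p) (castMap w) := fun k w => by
    rw [map_zsmul, map_zsmul, LinearMap.smul_apply, LinearMap.smul_apply, hξ]
  have hξD : ξ ∈ dualLattice (cuspLattice d I) BQK := mem_dualLattice_iff.mpr fun v => by
    rw [hξ]
    exact exists_int_of_mem_dualK3 (mem_iPerpDual.mp hp).1 v
  let S := (latticeImage (cuspLattice d I)).addSubgroupOf (dualLattice (cuspLattice d I) BQK)
  let q : dualLattice (cuspLattice d I) BQK →+ DiscriminantGroup (cuspLattice d I) BQK :=
    QuotientAddGroup.mk' S
  have hq : ∀ y, q y = 0 ↔ (y : ℚ ⊗[ℤ] cuspLattice d I) ∈ latticeImage (cuspLattice d I) :=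
    fun y => QuotientAddGroup.eq_zero_iff (N := S) y
  let f : ℤ →+ DiscriminantGroup (cuspLattice d I) BQK :=
    zmultiplesHom _ (q ⟨ξ, hξD⟩)
  have hf : ∀ k, f k = q (k • ⟨ξ, hξD⟩) := fun k => by
    rw [map_zsmul]
    rfl
  have hsurj : Function.Surjective f := by
    intro y
    obtain ⟨⟨η, hη⟩, rfl⟩ := QuotientAddGroup.mk_surjective (s := S) y
    obtain ⟨r, hr, hrη⟩ := exists_mem_iPerpDual_of_mem_dualLattice hd hisot hη
    obtain ⟨k, v, hv⟩ := hgen r hr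
    refine ⟨k, ?_⟩
    rw [hf]
    change _ = q ⟨η, hη⟩
    rw [eq_comm, ← sub_eq_zero, ← map_sub, hq]
    have hrk : r - k • p ∈ iPerpDual d I := sub_mem hr (AddSubgroup.zsmul_mem _ hp _)
    refine (mem_latticeImage_iff_of_represents hd hprim hB hrk fun w => ?_).mpr
      ⟨v, castMap_mem_iPerpDual.mp (hv ▸ hrk), ?_⟩
    · simp only [AddSubgroup.coe_sub, AddSubgroup.coe_zsmul]
      rw [map_sub, LinearMap.sub_apply, hξk, hrη, map_sub, LinearMap.sub_apply]
    · rw [hv, sub_self]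
      exact zero_mem _
  have hkerf : f.ker = AddSubgroup.zmultiples (n : ℤ) := by
    ext k
    rw [AddMonoidHom.mem_ker, hf, hq, Int.mem_zmultiples_iff, ← hker]
    exact mem_latticeImage_iff_of_represents hd hprim hB (AddSubgroup.zsmul_mem _ hp k) (hξk k)
  exact ⟨((QuotientAddGroup.quotientKerEquivOfSurjective f hsurj).symm.trans
    (QuotientAddGroup.quotientAddEquivOfEq hkerf)).trans (Int.quotientZMultiplesNatEquivZMod n)⟩

end CuspLattice

/-- Let `L = L_{2d}` and let `I ⊆ L` be a primitive totally isotropic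
sublattice of rank 2 whose imprimitivity group `H_I = (I^⊥_{L^∨})^⊥_{L^∨}/I` is cyclic of
order `N`.  Then `N²` divides `d`, and the discriminant group of the even lattice
`K = I^⊥_L/I` is cyclic of order `2m` where `m = d/N²`. -/
theorem imprimitivity_and_discriminant_of_cusp_lattice
    (d : ℕ) (hd : 0 < d)
    (I : Submodule ℤ (Fin 21 → ℤ))
    (hrank : Module.finrank ℤ ↥I = 2)
    (hprim : ∀ (v : Fin 21 → ℤ) (k : ℤ), k ≠ 0 → k • v ∈ I → v ∈ I)
    (hisot : ∀ v ∈ I, ∀ w ∈ I, bilinK3 d v w = 0)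
    (N : ℕ) (hN : 0 < N)
    (hHI : Nonempty (imprimitivityGroup d I ≃+ ZMod N)) :
    N ^ 2 ∣ d ∧
    ∀ (BK : cuspLattice d I →ₗ[ℤ] cuspLattice d I →ₗ[ℤ] ℤ),
      (∀ v w : ↥(iPerpLat d I),
          BK (QuotientAddGroup.mk v) (QuotientAddGroup.mk w) = bilinK3 d (v : Fin 21 → ℤ) w) →
      ∀ (BQK : (ℚ ⊗[ℤ] cuspLattice d I) →ₗ[ℚ] (ℚ ⊗[ℤ] cuspLattice d I) →ₗ[ℚ] ℚ),
        (∀ v w : cuspLattice d I,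
            BQK ((1 : ℚ) ⊗ₜ[ℤ] v) ((1 : ℚ) ⊗ₜ[ℤ] w) = (BK v w : ℚ)) →
        Nonempty (DiscriminantGroup (cuspLattice d I) BQK ≃+ ZMod (2 * (d / N ^ 2))) := by

  obtain ⟨e⟩ := hHI
  have hd' : (d : ℚ) ≠ 0 := by positivity
  obtain ⟨x, hx, k, hk, hNk, hgen⟩ := exists_generator hd hprim e
  obtain ⟨s, hs⟩ : ∃ s : ℤ, k ^ 2 = 4 * d * s := by
    obtain ⟨s, hs⟩ := exists_bilinK3Q_self_eq (mem_iPerpPerpDual.mp hx).1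
    rw [(mem_iPerpPerpDual.mp hx).2 x (iPerpPerpDual_le_iPerpDual hd hprim hisot hx)] at hs
    refine ⟨s, ?_⟩
    have : (k : ℚ) ^ 2 = 4 * d * s := by
      rw [← hk]
      linear_combination (2 * d : ℚ) * hs
    exact_mod_cast this
  obtain ⟨m, hdm, t, ht, hcop⟩ := exists_eq_sq_mul hd hN hNk hs
  have hm : 0 < m := by
    rcases Nat.eq_zero_or_pos m with rfl | h
    · omega
    · exact h
  have hN' : (N : ℚ) ≠ 0 := by positivity
  have hm' : (m : ℚ) ≠ 0 := by positivity
  have hdQ : (d : ℚ) = N ^ 2 * m := by exact_mod_cast hdm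
  have hx0 : (N : ℚ) * x 0 = t := by
    rw [ht, hdQ] at hk
    push_cast at hk
    have h : (2 * m * N : ℚ) ≠ 0 := by positivity
    apply mul_left_cancel₀ h
    linear_combination hk
  have hJ : ∀ z ∈ iPerpPerpDual d I, ∃ r : ℤ, (N : ℤ) * z 0 = r := by
    intro z hz
    obtain ⟨n, w, -, rfl⟩ := hgen z hz
    refine ⟨n * t + N * w 0, ?_⟩
    rw [Pi.add_apply, Pi.smul_apply, castMap_apply, zsmul_eq_mul]
    push_cast
    linear_combination (n : ℚ) * hx0
  obtain ⟨p, hp, hp0⟩ := exists_coord_zero_eq hd hprim hisot hJ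
  have hp0' : 2 * N * m * p 0 = 1 := by
    apply mul_left_cancel₀ hN'
    rw [hdQ] at hp0
    push_cast at hp0
    linear_combination hp0
  refine ⟨⟨m, hdm⟩, fun BK hBK BQK hBQK => ?_⟩
  have hdiv : d / N ^ 2 = m := by
    rw [hdm]
    exact Nat.mul_div_cancel_left m (by positivity)
  rw [hdiv]
  refine nonempty_discriminantGroup_equiv hd hprim hisot (fun v w => ?_) hp (fun q hq => ?_)
    fun n => ?_
  · rw [bilinK3Q_castMap, ← hBK v w]
    exact hBQK _ _
  · obtain ⟨a, ha⟩ := exists_int_coord_zero (mem_iPerpDual.mp hq).1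
    obtain ⟨n, rfl⟩ := dvd_coord_zero hx hq hk hNk ha
    refine ⟨n, ?_⟩
    obtain ⟨v, hv⟩ := exists_castMap_eq (x := q - n • p) (n := 0) (d := d)
      (sub_mem (mem_iPerpDual.mp hq).1 (AddSubgroup.zsmul_mem _ (mem_iPerpDual.mp hp).1 _)) (by
        rw [Pi.sub_apply, Pi.smul_apply, zsmul_eq_mul]
        have h : (2 * d : ℚ) ≠ 0 := by positivity
        apply mul_left_cancel₀ h
        push_cast at ha hp0 ⊢
        linear_combination ha - (n : ℚ) * hp0)
    exact ⟨v, hv.symm⟩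
  · constructor
    · rintro ⟨v, -, hv⟩
      obtain ⟨r, hr⟩ := hJ _ hv
      rw [Pi.sub_apply, Pi.smul_apply, castMap_apply, zsmul_eq_mul] at hr
      refine ⟨r + N * v 0, ?_⟩
      have : (n : ℚ) = 2 * m * (r + N * v 0) := by
        push_cast at hr
        linear_combination (2 * m : ℚ) * hr - (n : ℚ) * hp0'
      exact_mod_cast this
    · rintro ⟨r, rfl⟩
      obtain ⟨a, b, hab⟩ := hcop
      have hxP := iPerpPerpDual_le_iPerpDual hd hprim hisot hx
      have hy : ((2 * m : ℕ) * r) • p - (r * a) • x ∈ iPerpDual d I :=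
        sub_mem (AddSubgroup.zsmul_mem _ hp _) (AddSubgroup.zsmul_mem _ hxP _)
      obtain ⟨v, hv⟩ := exists_castMap_eq (n := r * b) (mem_iPerpDual.mp hy).1 (by
        rw [Pi.sub_apply, Pi.smul_apply, Pi.smul_apply, zsmul_eq_mul, zsmul_eq_mul]
        have hab' : (a * t + b * N : ℚ) = 1 := by exact_mod_cast hab
        apply mul_left_cancel₀ hN'
        push_cast
        linear_combination (r : ℚ) * hp0' - (r * a : ℚ) * hx0 - (r : ℚ) * hab')
      refine ⟨v, castMap_mem_iPerpDual.mp (hv ▸ hy), ?_⟩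
      rw [hv, sub_sub_cancel]
      exact AddSubgroup.zsmul_mem _ hx _
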